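/- Let k be a field of characteristic two and let α be an element of an algebraic closure of k that is algebraic of degree n over k, and assume the minimal polynomial of α over k is inseparable (not separable). Then there is no symmetric matrix M ∈ M_n(k) such that α is a root of the characteristic polynomial of M in the algebraic closure of k. -/

import Mathlib

open Polynomial
open scoped Matrix

theorem Matrix.IsSymm.aeval {R ι : Type*} [CommRing R] [Fintype ι] [DecidableEq ι]
    {M : Matrix ι ι R} (hM : M.IsSymm) (f : R[X]) : (Polynomial.aeval M f).IsSymm := by
  induction f using Polynomial.induction_on' with
  | add p q hp hq => simpa using hp.add hq
  | monomial j a =>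
    rw [Polynomial.aeval_monomial, ← Algebra.smul_def]
    exact (hM.pow j).smul a

/-- In characteristic two, the off-diagonal entries of a symmetric matrix cancel in pairs. -/
theorem Matrix.IsSymm.sum_sum_eq_trace {R ι : Type*} [CommRing R] [CharP R 2] [Fintype ι]
    {N : Matrix ι ι R} (hN : N.IsSymm) : ∑ i, ∑ j, N i j = N.trace := by
  classical
  have h : ∑ x : ι × ι, (if x.1 = x.2 then 0 else N x.1 x.2) = 0 := by
    refine Finset.sum_involution (fun x _ => x.swap) ?_ ?_ ?_ ?_
    · rintro ⟨i, j⟩ -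
      by_cases hij : i = j
      · simp [hij]
      · simp [hij, Ne.symm hij, hN.apply i j, CharTwo.add_self_eq_zero]
    · rintro ⟨i, j⟩ - hne heq
      simp_all
    · simp
    · simp
  have h' : ∑ x : ι × ι, (if x.1 = x.2 then N x.1 x.2 else 0) = N.trace := by
    simp [Fintype.sum_prod_type, Matrix.trace]
  rw [← Fintype.sum_prod_type' (f := N), ← h', ← sub_eq_zero, ← Finset.sum_sub_distrib]
  refine (Finset.sum_congr rfl fun x _ => ?_).trans h
  split_ifs <;> simp

/-- If `L` acts on `ι → k` by matrices and both have the same dimension over `k`, then every nonzero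
vector `v` identifies `L` with `ι → k` through `x ↦ φ x *ᵥ v`. -/
theorem Matrix.exists_linearEquiv_mulVec {k L ι : Type*} [Field k] [Field L] [Algebra k L]
    [FiniteDimensional k L] [Fintype ι] [DecidableEq ι] (φ : L →ₐ[k] Matrix ι ι k)
    (hL : Module.finrank k L = Fintype.card ι) {v : ι → k} (hv : v ≠ 0) :
    ∃ e : L ≃ₗ[k] (ι → k), ∀ x, e x = φ x *ᵥ v := by
  let f : L →ₗ[k] (ι → k) := (Matrix.mulVecBilin k k).flip v ∘ₗ φ.toLinearMap
  have hf : ∀ x, f x = φ x *ᵥ v := fun x => rfl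
  have hinj : Function.Injective f := by
    rw [injective_iff_map_eq_zero]
    intro x hx
    by_contra hx0
    apply hv
    rw [← Matrix.one_mulVec v, ← map_one φ, ← inv_mul_cancel₀ hx0, map_mul,
      ← Matrix.mulVec_mulVec, ← hf, hx, Matrix.mulVec_zero]
  exact ⟨LinearEquiv.ofInjectiveOfFinrankEq f hinj (by simpa using hL), hf⟩

theorem Matrix.trace_algHom_eq_algebraTrace {k L ι : Type*} [Field k] [Field L] [Algebra k L]
    [FiniteDimensional k L] [Fintype ι] [DecidableEq ι] [Nonempty ι] (φ : L →ₐ[k] Matrix ι ι k)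
    (hL : Module.finrank k L = Fintype.card ι) (x : L) :
    (φ x).trace = Algebra.trace k L x := by
  obtain ⟨e, he⟩ := Matrix.exists_linearEquiv_mulVec φ hL (v := 1) one_ne_zero
  rw [Algebra.trace_apply, ← LinearMap.trace_conj' _ e, ← Matrix.trace_toLin'_eq]
  congr 1
  refine LinearMap.ext fun y => ?_
  obtain ⟨y, rfl⟩ := e.surjective y
  rw [LinearEquiv.conj_apply_apply, e.symm_apply_apply]
  simp [he]

theorem not_eigenvalue_symmetric_matrix_of_inseparable
    {k : Type*} [Field k] [CharP k 2] (n : ℕ) (hn : 1 ≤ n)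
    (α : AlgebraicClosure k) (hint : IsIntegral k α)
    (hdeg : (minpoly k α).natDegree = n)
    (hinsep : ¬ (minpoly k α).Separable) :
    ¬ ∃ M : Matrix (Fin n) (Fin n) k, M.IsSymm ∧
      Polynomial.aeval α M.charpoly = 0 := by
  rintro ⟨M, hM, hα⟩
  have hmonic := minpoly.monic hint
  have hchar : M.charpoly = minpoly k α :=
    Polynomial.eq_of_monic_of_dvd_of_natDegree_le hmonic M.charpoly_monic (minpoly.dvd k α hα)
      (by simp [hdeg])
  have : Fact (Irreducible (minpoly k α)) := ⟨minpoly.irreducible hint⟩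
  have : NeZero n := ⟨by omega⟩
  have : FiniteDimensional k (AdjoinRoot (minpoly k α)) := hmonic.finite_adjoinRoot
  have hfin : Module.finrank k (AdjoinRoot (minpoly k α)) = Fintype.card (Fin n) := by
    rw [(AdjoinRoot.powerBasis hmonic.ne_zero).finrank, AdjoinRoot.powerBasis_dim, hdeg,
      Fintype.card_fin]
  have hnsep : ¬ Algebra.IsSeparable k (AdjoinRoot (minpoly k α)) := by
    intro h
    have := h.isSeparable' (AdjoinRoot.root (minpoly k α))
    rw [IsSeparable, AdjoinRoot.minpoly_root hmonic.ne_zero] at this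
    exact hinsep (by simpa [hmonic.leadingCoeff] using this)
  let φ : AdjoinRoot (minpoly k α) →ₐ[k] Matrix (Fin n) (Fin n) k :=
    Ideal.Quotient.liftₐ _ (Polynomial.aeval M) (by
      intro a ha
      obtain ⟨b, rfl⟩ := Ideal.mem_span_singleton.mp ha
      rw [← hchar, map_mul, Matrix.aeval_self_charpoly, zero_mul])
  have hsymm : ∀ x, (φ x).IsSymm := by
    intro x
    obtain ⟨f, rfl⟩ := AdjoinRoot.mk_surjective x
    exact hM.aeval f
  obtain ⟨e, he⟩ := Matrix.exists_linearEquiv_mulVec φ hfin (v := 1) one_ne_zero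
  have hsum : ∀ y : Fin n → k, ∑ i, y i = 0 := by
    intro y
    obtain ⟨x, rfl⟩ := e.surjective y
    have := (hsymm x).sum_sum_eq_trace
    rw [Matrix.trace_algHom_eq_algebraTrace φ hfin,
      Algebra.trace_eq_zero_of_not_isSeparable hnsep] at this
    simpa [he, Matrix.mulVec, dotProduct] using this
  simpa using hsum (Pi.single 0 1)
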